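/- Let f be a profile function and let Λ : ℕ → ℝ be the strictly increasing enumeration of E(f) = ⋃_{k ≥ 0} Spec L_k. Then for every natural number k ≥ 1 there exists a natural number m ≥ k such that Λ(m) ≤ m² + m. (Equivalently, there is an infinite strictly increasing sequence m_1 < m_2 < ⋯ of indices such that the m_k-th distinct eigenvalue of the Laplacian of (M,g) is at most the m_k-th distinct eigenvalue m_k² + m_k of the round sphere.) -/

import Mathlib

open Set MeasureTheory intervalIntegral Filter

/-- A profile function for a surface of revolution diffeomorphic to `S²` of area `4π`:
continuous on `[-1,1]`, smooth and positive on `(-1,1)`, vanishing at `±1`,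
with derivative `2` at `-1` and `-2` at `1`. -/
structure IsProfile (f : ℝ → ℝ) : Prop where
  contOn : ContinuousOn f (Icc (-1) 1)
  smoothOn : ContDiffOn ℝ (⊤ : ℕ∞) f (Ioo (-1) 1)
  pos : ∀ x ∈ Ioo (-1:ℝ) 1, 0 < f x
  zero_neg_one : f (-1) = 0
  zero_one : f 1 = 0
  deriv_neg_one : HasDerivAt f 2 (-1)
  deriv_one : HasDerivAt f (-2) 1

/-- `λ` is an eigenvalue of the Sturm–Liouville operator
`L_k = -(d/dx)(f(x) d/dx) + k²/f(x)` on `(-1,1)`, with Dirichlet boundary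
conditions at `±1` when `k ≥ 1`. -/
def InSpec (f : ℝ → ℝ) (k : ℕ) (lam : ℝ) : Prop :=
  ∃ u : ℝ → ℝ, ContinuousOn u (Icc (-1) 1) ∧ ContDiffOn ℝ (⊤ : ℕ∞) u (Ioo (-1) 1) ∧
    (∃ x ∈ Ioo (-1:ℝ) 1, u x ≠ 0) ∧
    (1 ≤ k → u (-1) = 0 ∧ u 1 = 0) ∧
    ∀ x ∈ Ioo (-1:ℝ) 1,
      -(deriv (fun y => f y * deriv u y) x) + ((k:ℝ)^2 / f x) * u x = lam * u x

/-- The spectrum of `L_k`. -/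
def Spec (f : ℝ → ℝ) (k : ℕ) : Set ℝ := {lam | InSpec f k lam}

/-- The set of distinct eigenvalues of the Laplacian of the surface of
revolution determined by `f`. -/
def Eigs (f : ℝ → ℝ) : Set ℝ := ⋃ k : ℕ, Spec f k

/-! ### Covariance operators on a Hilbert space -/

section Covariance

open scoped InnerProductSpace ENNReal

variable {H : Type*} [NormedAddCommGroup H] [InnerProductSpace ℝ H]
  {X : Type*} [MeasurableSpace X] {ρ : Measure X} {h : X → H}

/-- The operator `∫ h(x) ⊗ h(x) dρ(x)` associated with a square integrable `h : X → H`. -/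
noncomputable def covOp (ρ : Measure X) (h : X → H) : H →L[ℝ] H :=
  ∫ x, InnerProductSpace.rankOne ℝ (h x) (h x) ∂ρ

lemma integrable_rankOne_self (hh : MemLp h 2 ρ) :
    Integrable (fun x => InnerProductSpace.rankOne ℝ (h x) (h x)) ρ := by
  have hc : Continuous fun v : H => InnerProductSpace.rankOne ℝ v v := by
    have h1 : Continuous fun v : H => InnerProductSpace.rankOne ℝ (E := H) (F := H) v :=
      ContinuousLinearMap.continuous _
    exact h1.clm_apply continuous_id
  refine (hh.integrable_norm_pow two_ne_zero).mono
    (hc.comp_aestronglyMeasurable hh.aestronglyMeasurable) (.of_forall fun x => ?_)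
  simp [sq]

lemma Orthonormal.countable_of_separable [SecondCountableTopology H] {ι : Type*} {b : ι → H}
    (hb : Orthonormal ℝ b) : Countable ι := by
  refine Pairwise.countable_of_isOpen_disjoint (s := fun i => Metric.ball (b i) (1 / 2)) ?_
    (fun _ => Metric.isOpen_ball) (fun i => ⟨b i, by simp⟩)
  intro i j hij
  refine Metric.ball_disjoint_ball ?_
  have h1 : dist (b i) (b j) ^ 2 = 2 := by
    rw [dist_eq_norm, @norm_sub_sq_real, hb.1, hb.1, hb.2 hij]; norm_num
  nlinarith [dist_nonneg (x := b i) (y := b j)]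

variable [CompleteSpace H]

lemma inner_covOp (hh : MemLp h 2 ρ) (u v : H) :
    ⟪u, covOp ρ h v⟫_ℝ = ∫ x, ⟪h x, u⟫_ℝ * ⟪h x, v⟫_ℝ ∂ρ := by
  have hi := integrable_rankOne_self hh
  have hi' : Integrable (fun x => InnerProductSpace.rankOne ℝ (h x) (h x) v) ρ :=
    hi.apply_continuousLinearMap v
  rw [covOp, ContinuousLinearMap.integral_apply hi, ← integral_inner hi']
  refine integral_congr_ae (.of_forall fun x => ?_)
  simp [inner_smul_right, real_inner_comm, mul_comm]

lemma isSymmetric_covOp (hh : MemLp h 2 ρ) : (covOp ρ h : H →ₗ[ℝ] H).IsSymmetric := by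
  intro u v
  rw [real_inner_comm]
  change ⟪v, covOp ρ h u⟫_ℝ = ⟪u, covOp ρ h v⟫_ℝ
  rw [inner_covOp hh, inner_covOp hh]
  simp only [mul_comm]

lemma isCompactOperator_covOp (hh : MemLp h 2 ρ) : IsCompactOperator (covOp ρ h) := by
  let K : Submodule ℝ (H →L[ℝ] H) := compactOperator (RingHom.id ℝ) H H
  have : IsClosed (K : Set (H →L[ℝ] H)) := isClosed_setOfPred_isCompactOperator
  have hmem : ∀ x, InnerProductSpace.rankOne ℝ (h x) (h x) ∈ K := by
    intro x
    change IsCompactOperator (InnerProductSpace.rankOne ℝ (h x) (h x))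
    have h1 : IsCompactOperator (ContinuousLinearMap.toSpanSingleton ℝ (h x)) :=
      isCompactOperator_of_locallyCompactSpace_rng _
    exact h1.comp_clm (innerSL ℝ (h x))
  have hz : K.mkQL (covOp ρ h) = 0 := by
    have hcomm := ContinuousLinearMap.integral_comp_comm (𝕜 := ℝ)
      (Fₗ := (H →L[ℝ] H) ⧸ K) K.mkQL (integrable_rankOne_self hh)
    rw [covOp, ← hcomm]
    refine integral_eq_zero_of_ae (.of_forall fun x => ?_)
    exact (Submodule.Quotient.mk_eq_zero K).2 (hmem x)
  exact (Submodule.Quotient.mk_eq_zero K).1 hz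

/-- A compact symmetric operator with simple nonzero eigenvalues has a Hilbert basis of
eigenvectors. -/
lemma exists_hilbertBasis_eigenvectors {T : H →L[ℝ] H} (hT : IsCompactOperator T)
    (hs : (T : H →ₗ[ℝ] H).IsSymmetric)
    (hsimple : ∀ μ : ℝ, μ ≠ 0 → ∀ u v : H, T u = μ • u → T v = μ • v →
      ⟪u, v⟫_ℝ = 0 → u = 0 ∨ v = 0) :
    ∃ (w : Set H) (b : HilbertBasis w ℝ H) (ev : w → ℝ), ∀ i, T (b i) = ev i • b i := by
  let M := {μ : ℝ // μ ≠ 0 ∧ ∃ e : H, ‖e‖ = 1 ∧ T e = μ • e}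
  choose e he1 heT using fun μ : M => μ.2.2
  have horth : Orthonormal ℝ e := by
    refine ⟨he1, fun μ ν hμν => ?_⟩
    have h1 : ⟪T (e μ), e ν⟫_ℝ = ⟪e μ, T (e ν)⟫_ℝ := hs _ _
    rw [heT, heT, inner_smul_left, inner_smul_right] at h1
    have h2 : (μ.1 - ν.1) * ⟪e μ, e ν⟫_ℝ = 0 := by
      simp only [conj_trivial] at h1; linarith
    exact (mul_eq_zero.1 h2).resolve_left (sub_ne_zero.2 fun h => hμν (Subtype.ext h))
  obtain ⟨w, b, hw, hb⟩ := horth.toSubtypeRange.exists_hilbertBasis_extension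
  have key : ∀ i : w, ∃ c : ℝ, T (b i) = c • b i := by
    intro i
    by_cases hi : (i : H) ∈ range e
    · obtain ⟨μ, hμ⟩ := hi
      exact ⟨μ.1, by rw [hb, ← hμ, heT]⟩
    refine ⟨0, ?_⟩
    rw [zero_smul]
    have hperp : ∀ μ : M, ⟪e μ, b i⟫_ℝ = 0 := by
      intro μ
      have hne : (⟨e μ, hw ⟨μ, rfl⟩⟩ : w) ≠ i := fun h => hi ⟨μ, congrArg Subtype.val h⟩
      have := b.orthonormal.2 hne
      rwa [hb] at this ⊢
    have hall : T (b i) ∈ (⨆ μ, Module.End.eigenspace (T : H →ₗ[ℝ] H) μ)ᗮ := by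
      rw [← Submodule.iInf_orthogonal, Submodule.mem_iInf]
      intro μ v hv
      have hv' : T v = μ • v := Module.End.mem_eigenspace_iff.1 hv
      have h1 : ⟪T v, b i⟫_ℝ = ⟪v, T (b i)⟫_ℝ := hs _ _
      rw [← h1, hv', inner_smul_left]
      by_cases hμ : μ = 0
      · simp [hμ]
      by_cases hv0 : v = 0
      · simp [hv0]
      have hn : ‖v‖ ≠ 0 := norm_ne_zero_iff.2 hv0
      let m : M := ⟨μ, hμ, ‖v‖⁻¹ • v, by simp [norm_smul, hn], by
        rw [map_smul, hv', smul_comm]⟩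
      have hTe : T (e m) = μ • e m := heT m
      have h2 := hsimple μ hμ (e m) (v - ⟪e m, v⟫_ℝ • e m) hTe
        (by rw [map_sub, map_smul, hTe, hv', smul_sub, smul_comm])
        (by rw [inner_sub_right, inner_smul_right, real_inner_self_eq_norm_sq, he1]; ring)
      have hem : e m ≠ 0 := fun h => by simpa [h] using he1 m
      have h3 : v = ⟪e m, v⟫_ℝ • e m := sub_eq_zero.1 (h2.resolve_left hem)
      rw [h3, inner_smul_left, hperp]
      simp
    rw [ContinuousLinearMap.orthogonalComplement_iSup_eigenspaces_eq_bot hT hs] at hall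
    exact (Submodule.mem_bot ℝ).1 hall
  choose ev hev using key
  exact ⟨w, b, ev, hev⟩

/-- The Rayleigh quotient of a compact symmetric operator is at most its largest eigenvalue. -/
lemma inner_le_of_forall_eigenvalue_le {T : H →L[ℝ] H} (hT : IsCompactOperator T)
    (hs : (T : H →ₗ[ℝ] H).IsSymmetric)
    (hsimple : ∀ μ : ℝ, μ ≠ 0 → ∀ u v : H, T u = μ • u → T v = μ • v →
      ⟪u, v⟫_ℝ = 0 → u = 0 ∨ v = 0)
    {c : ℝ} (hc : 0 ≤ c) (hev : ∀ μ : ℝ, μ ≠ 0 → ∀ u : H, u ≠ 0 → T u = μ • u → μ ≤ c) (x : H) :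
    ⟪x, T x⟫_ℝ ≤ c * ‖x‖ ^ 2 := by
  obtain ⟨w, b, ev, hb⟩ := exists_hilbertBasis_eigenvectors hT hs hsimple
  have h1 := b.hasSum_inner_mul_inner x (T x)
  have h2 := (b.hasSum_inner_mul_inner x x).mul_left c
  rw [← real_inner_self_eq_norm_sq]
  refine hasSum_le (fun i => ?_) h1 h2
  have h3 : ⟪T (b i), x⟫_ℝ = ⟪b i, T x⟫_ℝ := hs _ _
  rw [← h3, hb, inner_smul_left, real_inner_comm x (b i)]
  simp only [conj_trivial]
  have hle : ev i ≤ c := by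
    by_cases h0 : ev i = 0
    · rwa [h0]
    · exact hev _ h0 (b i) (b.orthonormal.ne_zero i) (hb i)
  nlinarith [mul_self_nonneg ⟪b i, x⟫_ℝ]

/-- The trace of a covariance operator with simple eigenvalues is the sum of its eigenvalues. -/
lemma lintegral_enorm_sq_le_tsum_eigenvalues [SecondCountableTopology H] (hh : MemLp h 2 ρ)
    (hsimple : ∀ μ : ℝ, μ ≠ 0 → ∀ u v : H, covOp ρ h u = μ • u → covOp ρ h v = μ • v →
      ⟪u, v⟫_ℝ = 0 → u = 0 ∨ v = 0) :
    ∫⁻ x, ENNReal.ofReal (‖h x‖ ^ 2) ∂ρ ≤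
      ∑' μ : {μ : ℝ // μ ≠ 0 ∧ ∃ u : H, u ≠ 0 ∧ covOp ρ h u = μ • u}, ENNReal.ofReal μ := by
  obtain ⟨w, b, ev, hb⟩ := exists_hilbertBasis_eigenvectors (isCompactOperator_covOp hh)
    (isSymmetric_covOp hh) hsimple
  have : Countable w := b.orthonormal.countable_of_separable
  have hmeas : ∀ i, AEMeasurable (fun x => ENNReal.ofReal (⟪h x, b i⟫_ℝ * ⟪h x, b i⟫_ℝ)) ρ := by
    intro i
    have := hh.aestronglyMeasurable.inner (𝕜 := ℝ) (aestronglyMeasurable_const (b := b i))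
    exact (this.mul this).aemeasurable.ennreal_ofReal
  have hprod : ∀ i, Integrable (fun x => ⟪h x, b i⟫_ℝ * ⟪h x, b i⟫_ℝ) ρ := by
    intro i
    have := (MemLp.const_inner (𝕜 := ℝ) (b i) hh).integrable_sq
    simpa [sq, real_inner_comm] using this
  have hval : ∀ i, ∫⁻ x, ENNReal.ofReal (⟪h x, b i⟫_ℝ * ⟪h x, b i⟫_ℝ) ∂ρ
      = ENNReal.ofReal (ev i) := by
    intro i
    rw [← ofReal_integral_eq_lintegral_ofReal (hprod i) (.of_forall fun x => mul_self_nonneg _),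
      ← inner_covOp hh, hb, inner_smul_right, real_inner_self_eq_norm_sq, b.orthonormal.1]
    simp
  calc ∫⁻ x, ENNReal.ofReal (‖h x‖ ^ 2) ∂ρ
      = ∫⁻ x, ∑' i, ENNReal.ofReal (⟪h x, b i⟫_ℝ * ⟪h x, b i⟫_ℝ) ∂ρ := by
        refine lintegral_congr fun x => ?_
        have h1 := b.hasSum_inner_mul_inner (h x) (h x)
        simp only [real_inner_comm (h x)] at h1
        rw [← ENNReal.ofReal_tsum_of_nonneg (fun i => mul_self_nonneg _),
          ← real_inner_self_eq_norm_sq]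
        · congr 1
          rw [← h1.tsum_eq]
        · simpa only [real_inner_comm (h x)] using h1.summable
    _ = ∑' i, ENNReal.ofReal (ev i) := by
        rw [lintegral_tsum hmeas]
        exact tsum_congr hval
    _ = ∑' i : Function.support fun i => ENNReal.ofReal (ev i), ENNReal.ofReal (ev i) :=
        (tsum_subtype_support _).symm
    _ ≤ _ := by
        have hne : ∀ i : Function.support fun i => ENNReal.ofReal (ev i), ev i ≠ 0 := by
          intro i h0
          exact i.2 (by simp [h0])
        let φ : (Function.support fun i => ENNReal.ofReal (ev i)) →
            {μ : ℝ // μ ≠ 0 ∧ ∃ u : H, u ≠ 0 ∧ covOp ρ h u = μ • u} :=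
          fun i => ⟨ev i, hne i, b i, b.orthonormal.ne_zero _, hb i⟩
        have hφ : Function.Injective φ := by
          intro i j hij
          by_contra hne'
          have hevij : ev i = ev j := congrArg Subtype.val hij
          rcases hsimple (ev i) (hne i) (b i) (b j) (hb i) (hevij ▸ hb j)
            (b.orthonormal.2 fun h => hne' (Subtype.ext h)) with h0 | h0 <;>
          exact b.orthonormal.ne_zero _ h0
        exact ENNReal.tsum_comp_le_tsum_of_injective hφ (fun μ => ENNReal.ofReal μ.1)

end Covariance

/-! ### The Green operator of `-d²/ds² + k²` -/

section Green

open scoped InnerProductSpace ENNReal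

variable {k : ℝ} {m : Measure ℝ} {s : ℝ → ℝ}

/-- The kernel of `(d/ds + k)⁻¹`, read in the coordinate `x`. -/
noncomputable def halfKernel (k : ℝ) (s : ℝ → ℝ) (r x : ℝ) : ℝ :=
  if r < s x then Real.exp (-k * (s x - r)) else 0

/-- The Green function of `-d²/ds² + k²`, read in the coordinate `x`. -/
noncomputable def greenKernel (k : ℝ) (s : ℝ → ℝ) (x y : ℝ) : ℝ :=
  Real.exp (-k * |s x - s y|) / (2 * k)

lemma halfKernel_nonneg (r x : ℝ) : 0 ≤ halfKernel k s r x := by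
  unfold halfKernel; split_ifs <;> positivity

lemma halfKernel_le_one (hk : 0 < k) (r x : ℝ) : halfKernel k s r x ≤ 1 := by
  unfold halfKernel; split_ifs with h
  · rw [Real.exp_le_one_iff]; nlinarith
  · exact zero_le_one

lemma measurable_halfKernel (hs : Measurable s) :
    Measurable fun p : ℝ × ℝ => halfKernel k s p.1 p.2 := by
  unfold halfKernel
  refine Measurable.ite (measurableSet_lt measurable_fst (hs.comp measurable_snd)) ?_
    measurable_const
  fun_prop

lemma measurable_greenKernel (hs : Measurable s) :
    Measurable fun p : ℝ × ℝ => greenKernel k s p.1 p.2 := by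
  unfold greenKernel
  have h1 : Measurable fun p : ℝ × ℝ => s p.1 - s p.2 := by fun_prop
  have h2 : Measurable fun p : ℝ × ℝ => |s p.1 - s p.2| := measurable_norm.comp h1
  fun_prop

lemma greenKernel_pos (hk : 0 < k) (x y : ℝ) : 0 < greenKernel k s x y := by
  unfold greenKernel; positivity

lemma greenKernel_le (hk : 0 < k) (x y : ℝ) : greenKernel k s x y ≤ 1 / (2 * k) := by
  unfold greenKernel
  gcongr
  rw [Real.exp_le_one_iff]
  nlinarith [abs_nonneg (s x - s y)]

lemma norm_greenKernel_le (hk : 0 < k) (x y : ℝ) : ‖greenKernel k s x y‖ ≤ 1 / (2 * k) := by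
  rw [Real.norm_of_nonneg (greenKernel_pos hk x y).le]
  exact greenKernel_le hk x y

lemma greenKernel_lt {k k' : ℝ} (hk : 0 < k) (hkk' : k < k') (x y : ℝ) :
    greenKernel k' s x y < greenKernel k s x y := by
  unfold greenKernel
  have h1 : Real.exp (-k' * |s x - s y|) ≤ Real.exp (-k * |s x - s y|) := by
    rw [Real.exp_le_exp]; nlinarith [abs_nonneg (s x - s y)]
  have h2 := Real.exp_pos (-k * |s x - s y|)
  calc _ ≤ Real.exp (-k * |s x - s y|) / (2 * k') := by gcongr; linarith
    _ < _ := by gcongr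

lemma halfKernel_mul_halfKernel (x y : ℝ) :
    (fun r => halfKernel k s r x * halfKernel k s r y) =
      (Iio (min (s x) (s y))).indicator
        fun r => Real.exp (-k * (s x + s y)) * Real.exp (2 * k * r) := by
  ext r
  unfold halfKernel
  by_cases h : r ∈ Iio (min (s x) (s y))
  · have h' := lt_min_iff.1 (mem_Iio.1 h)
    rw [indicator_of_mem h, if_pos h'.1, if_pos h'.2, ← Real.exp_add, ← Real.exp_add]
    ring_nf
  · rw [indicator_of_notMem h]
    rw [mem_Iio, lt_min_iff, not_and_or] at h
    rcases h with h | h <;> simp [h]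

lemma integrable_halfKernel_mul (hk : 0 < k) (x y : ℝ) :
    Integrable fun r => halfKernel k s r x * halfKernel k s r y := by
  rw [halfKernel_mul_halfKernel, integrable_indicator_iff measurableSet_Iio]
  exact ((integrableOn_exp_mul_Iic (by positivity : 0 < 2 * k) _).mono_set
    Iio_subset_Iic_self).const_mul _

lemma integral_halfKernel_mul (hk : 0 < k) (x y : ℝ) :
    ∫ r, halfKernel k s r x * halfKernel k s r y = greenKernel k s x y := by
  rw [halfKernel_mul_halfKernel, MeasureTheory.integral_indicator measurableSet_Iio,
    ← integral_Iic_eq_integral_Iio, MeasureTheory.integral_const_mul,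
    integral_exp_mul_Iic (by positivity), greenKernel, ← mul_div_assoc, ← Real.exp_add]
  congr 2
  rcases le_total (s x) (s y) with h | h
  · rw [min_eq_left h, abs_of_nonpos (by linarith)]; ring
  · rw [min_eq_right h, abs_of_nonneg (by linarith)]; ring

lemma memLp_halfKernel [IsFiniteMeasure m] (hk : 0 < k) (hs : Measurable s) (r : ℝ) :
    MemLp (halfKernel k s r) 2 m := by
  refine MemLp.of_bound ((measurable_halfKernel hs).comp
    measurable_prodMk_left).aestronglyMeasurable 1 (.of_forall fun x => ?_)
  rw [Real.norm_of_nonneg (halfKernel_nonneg r x)]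
  exact halfKernel_le_one hk r x

/-- The function `halfKernel k s r` as an element of `L²`. -/
noncomputable def halfVec (m : Measure ℝ) [IsFiniteMeasure m] (hk : 0 < k) (hs : Measurable s)
    (r : ℝ) : Lp ℝ 2 m :=
  (memLp_halfKernel hk hs r).toLp _

lemma norm_toLp_sq {g : ℝ → ℝ} (hg : MemLp g 2 m) : ‖hg.toLp g‖ ^ 2 = ∫ x, g x * g x ∂m := by
  rw [← real_inner_self_eq_norm_sq, L2.inner_def]
  refine integral_congr_ae ?_
  filter_upwards [hg.coeFn_toLp] with x hx
  simp [hx, sq]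

variable [IsFiniteMeasure m]

lemma inner_halfVec (hk : 0 < k) (hs : Measurable s) (r : ℝ) (u : Lp ℝ 2 m) :
    ⟪halfVec m hk hs r, u⟫_ℝ = ∫ x, halfKernel k s r x * u x ∂m := by
  rw [L2.inner_def]
  refine integral_congr_ae ?_
  filter_upwards [(memLp_halfKernel (m := m) hk hs r).coeFn_toLp] with x hx
  simp [halfVec, hx, mul_comm]

lemma continuous_halfVec (hk : 0 < k) (hs : Measurable s) (hatom : ∀ r, m {x | s x = r} = 0) :
    Continuous (halfVec m hk hs) := by
  rw [continuous_iff_continuousAt]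
  intro r₀
  rw [ContinuousAt, tendsto_iff_norm_sub_tendsto_zero]
  have hsq : Tendsto (fun r => ‖halfVec m hk hs r - halfVec m hk hs r₀‖ ^ 2) (nhds r₀)
      (nhds 0) := by
    have heq : ∀ r, ‖halfVec m hk hs r - halfVec m hk hs r₀‖ ^ 2 =
        ∫ x, (halfKernel k s r x - halfKernel k s r₀ x) *
          (halfKernel k s r x - halfKernel k s r₀ x) ∂m := by
      intro r
      rw [halfVec, halfVec, ← MemLp.toLp_sub, norm_toLp_sq]
      rfl
    simp only [heq]
    have h0 : (0 : ℝ) = ∫ _ : ℝ, (0 : ℝ) ∂m := by simp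
    rw [h0]
    refine tendsto_integral_filter_of_dominated_convergence (fun _ => 1) ?_ ?_
      (integrable_const _) ?_
    · refine .of_forall fun r => ?_
      have := ((memLp_halfKernel (m := m) hk hs r).sub
        (memLp_halfKernel hk hs r₀)).aestronglyMeasurable
      exact this.mul this
    · refine .of_forall fun r => .of_forall fun x => ?_
      have h1 := halfKernel_nonneg (k := k) (s := s) r x
      have h2 := halfKernel_le_one (s := s) hk r x
      have h3 := halfKernel_nonneg (k := k) (s := s) r₀ x
      have h4 := halfKernel_le_one (s := s) hk r₀ x
      rw [Real.norm_of_nonneg (mul_self_nonneg _)]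
      nlinarith
    · have hae : ∀ᵐ x ∂m, s x ≠ r₀ := by
        rw [ae_iff]; simpa using hatom r₀
      filter_upwards [hae] with x hx
      have hlim : Tendsto (fun r => halfKernel k s r x) (nhds r₀)
          (nhds (halfKernel k s r₀ x)) := by
        rcases lt_or_gt_of_ne hx with h | h
        · refine tendsto_const_nhds.congr' ?_
          filter_upwards [lt_mem_nhds h] with r hr
          simp [halfKernel, h.not_gt, hr.not_gt]
        · have hc : Continuous fun r => Real.exp (-k * (s x - r)) := by fun_prop
          have := hc.tendsto r₀
          rw [halfKernel, if_pos h]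
          refine this.congr' ?_
          filter_upwards [gt_mem_nhds h] with r hr
          rw [halfKernel, if_pos hr]
      have hsub := hlim.sub_const (halfKernel k s r₀ x)
      simpa using hsub.mul hsub
  have := hsq.sqrt
  simpa [Real.sqrt_sq] using this

lemma lintegral_norm_halfVec_sq (hk : 0 < k) (hs : Measurable s) :
    ∫⁻ r, ENNReal.ofReal (‖halfVec m hk hs r‖ ^ 2) = ENNReal.ofReal (1 / (2 * k)) * m univ := by
  have h1 : ∀ r, ENNReal.ofReal (‖halfVec m hk hs r‖ ^ 2) =
      ∫⁻ x, ENNReal.ofReal (halfKernel k s r x * halfKernel k s r x) ∂m := by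
    intro r
    rw [halfVec, norm_toLp_sq, ofReal_integral_eq_lintegral_ofReal]
    · simpa [sq] using (memLp_halfKernel (m := m) hk hs r).integrable_sq
    · exact .of_forall fun x => mul_self_nonneg _
  simp only [h1]
  rw [lintegral_lintegral_swap]
  · have h2 : ∀ x, ∫⁻ r, ENNReal.ofReal (halfKernel k s r x * halfKernel k s r x) =
        ENNReal.ofReal (1 / (2 * k)) := by
      intro x
      rw [← ofReal_integral_eq_lintegral_ofReal (integrable_halfKernel_mul hk x x)
        (.of_forall fun r => mul_self_nonneg _), integral_halfKernel_mul hk]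
      simp [greenKernel]
    simp [h2]
  · have := measurable_halfKernel (k := k) hs
    exact (this.mul this).ennreal_ofReal.aemeasurable

lemma memLp_halfVec (hk : 0 < k) (hs : Measurable s) (hatom : ∀ r, m {x | s x = r} = 0) :
    MemLp (halfVec m hk hs) 2 volume := by
  have hc := (continuous_halfVec hk hs hatom).aestronglyMeasurable (μ := volume)
  rw [memLp_two_iff_integrable_sq_norm hc]
  refine ⟨hc.norm.pow 2, ?_⟩
  rw [hasFiniteIntegral_iff_ofReal (.of_forall fun r => by positivity),
    lintegral_norm_halfVec_sq]
  exact ENNReal.mul_lt_top ENNReal.ofReal_lt_top (measure_lt_top _ _)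

/-- The Green operator on `L²`. -/
noncomputable def greenOp (m : Measure ℝ) [IsFiniteMeasure m] (hk : 0 < k) (hs : Measurable s) :
    Lp ℝ 2 m →L[ℝ] Lp ℝ 2 m :=
  covOp volume (halfVec m hk hs)

lemma integrable_coe_L2 (u : Lp ℝ 2 m) : Integrable u m :=
  (Lp.memLp u).integrable (by norm_num)

lemma integrable_greenKernel_mul (hk : 0 < k) (hs : Measurable s) (u v : Lp ℝ 2 m) :
    Integrable (fun p : ℝ × ℝ => greenKernel k s p.1 p.2 * (u p.1 * v p.2)) (m.prod m) := by
  refine ((integrable_coe_L2 u).mul_prod (integrable_coe_L2 v)).bdd_mul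
    (measurable_greenKernel hs).aestronglyMeasurable
    (.of_forall fun p => norm_greenKernel_le hk p.1 p.2)

lemma inner_greenOp (hk : 0 < k) (hs : Measurable s) (hatom : ∀ r, m {x | s x = r} = 0)
    (u v : Lp ℝ 2 m) :
    ⟪u, greenOp m hk hs v⟫_ℝ =
      ∫ p : ℝ × ℝ, greenKernel k s p.1 p.2 * (u p.1 * v p.2) ∂(m.prod m) := by
  rw [greenOp, inner_covOp (memLp_halfVec hk hs hatom)]
  have h1 : ∀ r, ⟪halfVec m hk hs r, u⟫_ℝ * ⟪halfVec m hk hs r, v⟫_ℝ =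
      ∫ p : ℝ × ℝ, (halfKernel k s r p.1 * halfKernel k s r p.2) * (u p.1 * v p.2)
        ∂(m.prod m) := by
    intro r
    rw [inner_halfVec, inner_halfVec, ← integral_prod_mul]
    exact integral_congr_ae (.of_forall fun p => by ring)
  simp only [h1]
  rw [integral_integral_swap]
  · refine integral_congr_ae (.of_forall fun p => ?_)
    simp only
    rw [MeasureTheory.integral_mul_const, integral_halfKernel_mul hk]
  · have hm : AEStronglyMeasurable (Function.uncurry fun (r : ℝ) (p : ℝ × ℝ) =>
        (halfKernel k s r p.1 * halfKernel k s r p.2) * (u p.1 * v p.2))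
        (volume.prod (m.prod m)) := by
      have ha := measurable_halfKernel (k := k) hs
      have hu := (Lp.stronglyMeasurable u).measurable
      have hv := (Lp.stronglyMeasurable v).measurable
      have h1 : Measurable fun q : ℝ × ℝ × ℝ => halfKernel k s q.1 q.2.1 :=
        ha.comp (measurable_fst.prodMk (measurable_fst.comp measurable_snd))
      have h2 : Measurable fun q : ℝ × ℝ × ℝ => halfKernel k s q.1 q.2.2 :=
        ha.comp (measurable_fst.prodMk (measurable_snd.comp measurable_snd))
      exact ((h1.mul h2).mul ((hu.comp (measurable_fst.comp measurable_snd)).mul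
        (hv.comp (measurable_snd.comp measurable_snd)))).aestronglyMeasurable
    rw [integrable_prod_iff' hm]
    refine ⟨.of_forall fun p =>
      (integrable_halfKernel_mul (s := s) hk p.1 p.2).mul_const (u p.1 * v p.2), ?_⟩
    refine (integrable_greenKernel_mul hk hs u v).norm.congr (.of_forall fun p => ?_)
    simp only [Function.uncurry, norm_mul]
    rw [← integral_halfKernel_mul hk, MeasureTheory.integral_mul_const,
      Real.norm_of_nonneg (integral_nonneg fun r =>
        mul_nonneg (halfKernel_nonneg r _) (halfKernel_nonneg r _))]
    congr 1
    refine integral_congr_ae (.of_forall fun r => ?_)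
    simp only
    rw [Real.norm_of_nonneg (halfKernel_nonneg _ _), Real.norm_of_nonneg (halfKernel_nonneg _ _)]

lemma memLp_integral_greenKernel (hk : 0 < k) (hs : Measurable s) (v : Lp ℝ 2 m) :
    MemLp (fun x => ∫ y, greenKernel k s x y * v y ∂m) 2 m := by
  have hm : StronglyMeasurable fun x => ∫ y, greenKernel k s x y * v y ∂m := by
    refine StronglyMeasurable.integral_prod_right
      (f := fun x y => greenKernel k s x y * v y) ?_
    exact (measurable_greenKernel hs).stronglyMeasurable.mul
      ((Lp.stronglyMeasurable v).comp_measurable measurable_snd)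
  refine MemLp.of_bound hm.aestronglyMeasurable (1 / (2 * k) * ∫ y, ‖v y‖ ∂m)
    (.of_forall fun x => ?_)
  rw [← MeasureTheory.integral_const_mul]
  refine norm_integral_le_of_norm_le ((integrable_coe_L2 v).norm.const_mul _)
    (.of_forall fun y => ?_)
  rw [norm_mul]
  gcongr
  exact norm_greenKernel_le hk x y

lemma greenOp_ae_eq (hk : 0 < k) (hs : Measurable s) (hatom : ∀ r, m {x | s x = r} = 0)
    (v : Lp ℝ 2 m) :
    greenOp m hk hs v =ᵐ[m] fun x => ∫ y, greenKernel k s x y * v y ∂m := by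
  have hmem := memLp_integral_greenKernel hk hs v
  have : greenOp m hk hs v = hmem.toLp _ := by
    refine ext_inner_left ℝ fun u => ?_
    rw [inner_greenOp hk hs hatom, integral_prod _ (integrable_greenKernel_mul hk hs u v),
      L2.inner_def]
    refine integral_congr_ae ?_
    filter_upwards [hmem.coeFn_toLp] with x hx
    rw [hx]
    simp only [RCLike.inner_apply, conj_trivial]
    rw [← MeasureTheory.integral_mul_const]
    exact integral_congr_ae (.of_forall fun y => by ring)
  rw [this]
  exact hmem.coeFn_toLp

/-- Decreasing `k` strictly increases the Rayleigh quotient at the absolute value. -/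
lemma exists_inner_greenOp_lt {k' : ℝ} (hk : 0 < k) (hk' : 0 < k') (hkk' : k < k')
    (hs : Measurable s) (hatom : ∀ r, m {x | s x = r} = 0) {u : Lp ℝ 2 m} (hu : u ≠ 0) :
    ∃ w : Lp ℝ 2 m, ‖w‖ = ‖u‖ ∧ ⟪u, greenOp m hk' hs u⟫_ℝ < ⟪w, greenOp m hk hs w⟫_ℝ := by
  refine ⟨|u|, norm_abs_eq_norm u, ?_⟩
  have habs : ∀ᵐ p ∂(m.prod m),
      (|u| : Lp ℝ 2 m) p.1 * (|u| : Lp ℝ 2 m) p.2 = |u p.1| * |u p.2| := by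
    have h1 := Lp.coeFn_abs u
    filter_upwards [Measure.quasiMeasurePreserving_fst.ae h1,
      Measure.quasiMeasurePreserving_snd.ae h1] with p hp hq
    rw [hp, hq]
  have hi := integrable_greenKernel_mul hk hs |u| |u|
  have hi' := integrable_greenKernel_mul hk' hs |u| |u|
  have hlt : ∫ p : ℝ × ℝ, greenKernel k' s p.1 p.2 * ((|u| : Lp ℝ 2 m) p.1 * (|u| : Lp ℝ 2 m) p.2)
        ∂(m.prod m) <
      ∫ p : ℝ × ℝ, greenKernel k s p.1 p.2 * ((|u| : Lp ℝ 2 m) p.1 * (|u| : Lp ℝ 2 m) p.2)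
        ∂(m.prod m) := by
    have hnn : 0 ≤ᵐ[m.prod m] fun p : ℝ × ℝ =>
        greenKernel k s p.1 p.2 * ((|u| : Lp ℝ 2 m) p.1 * (|u| : Lp ℝ 2 m) p.2) -
        greenKernel k' s p.1 p.2 * ((|u| : Lp ℝ 2 m) p.1 * (|u| : Lp ℝ 2 m) p.2) := by
      filter_upwards [habs] with p hp
      rw [hp, ← sub_mul]
      exact mul_nonneg (sub_nonneg.2 (greenKernel_lt hk hkk' _ _).le) (by positivity)
    rw [← sub_pos, ← integral_sub hi hi']
    refine lt_of_le_of_ne (integral_nonneg_of_ae hnn) fun h0 => hu ?_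
    have hz := (integral_eq_zero_iff_of_nonneg_ae hnn (hi.sub hi')).1 h0.symm
    have hprod : ∫ p : ℝ × ℝ, ‖u p.1‖ * ‖u p.2‖ ∂(m.prod m) = 0 := by
      refine integral_eq_zero_of_ae ?_
      filter_upwards [hz, habs] with p hp hq
      simp only [Pi.zero_apply] at hp
      rw [hq, ← sub_mul] at hp
      exact (mul_eq_zero.1 hp).resolve_left (sub_pos.2 (greenKernel_lt hk hkk' _ _)).ne'
    rw [integral_prod_mul (fun x => ‖u x‖) (fun x => ‖u x‖)] at hprod
    have h1 := mul_self_eq_zero.1 hprod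
    have h2 := (integral_eq_zero_iff_of_nonneg (fun x => norm_nonneg _)
      (integrable_coe_L2 u).norm).1 h1
    refine (Lp.eq_zero_iff_ae_eq_zero).2 ?_
    filter_upwards [h2] with x hx
    exact norm_eq_zero.1 hx
  rw [inner_greenOp hk' hs hatom, inner_greenOp hk hs hatom]
  refine lt_of_le_of_lt ?_ hlt
  refine integral_mono_ae (integrable_greenKernel_mul hk' hs u u) hi' ?_
  filter_upwards [habs] with p hp
  rw [hp, ← abs_mul]
  exact mul_le_mul_of_nonneg_left (le_abs_self _) (greenKernel_pos hk' _ _).le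

end Green

/-! ### The arc coordinate of a profile -/

section Coordinate

open Topology

/-- A coordinate `s` on `(-1, 1)` with `ds = dx / f`, running from `-∞` to `∞`. -/
structure IsCoordinate (f s : ℝ → ℝ) : Prop where
  measurable : Measurable s
  hasDerivAt : ∀ x ∈ Ioo (-1 : ℝ) 1, HasDerivAt s (1 / f x) x
  tendsto_left : Tendsto s (𝓝[>] (-1)) atBot
  tendsto_right : Tendsto s (𝓝[<] 1) atTop

lemma tendsto_atBot_of_hasDerivAt {f s : ℝ → ℝ} {a b : ℝ} (hab : a < b)
    (hpos : ∀ x ∈ Ioo a b, 0 < f x) (hs : ∀ x ∈ Ioo a b, HasDerivAt s (1 / f x) x)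
    {c : ℝ} (hfa : f a = 0) (hf : HasDerivAt f c a) : Tendsto s (𝓝[>] a) atBot := by
  set C := |c| + 1
  have hC : 0 < C := by positivity
  have hb : ∀ᶠ x in 𝓝 a, |f x| ≤ C * |x - a| := by
    have h1 := (hasDerivAt_iff_isLittleO.1 hf).bound one_pos
    filter_upwards [h1] with x hx
    rw [hfa, sub_zero, smul_eq_mul, Real.norm_eq_abs, Real.norm_eq_abs, one_mul] at hx
    calc |f x| = |(f x - (x - a) * c) + (x - a) * c| := by ring_nf
      _ ≤ |f x - (x - a) * c| + |(x - a) * c| := abs_add_le _ _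
      _ ≤ C * |x - a| := by rw [abs_mul]; simp only [C]; linarith
  obtain ⟨ε, hε, hball⟩ := Metric.eventually_nhds_iff.1 hb
  set d := min b (a + ε)
  have had : a < d := lt_min hab (by linarith)
  set e := (a + d) / 2
  have hae : a < e := by simp only [e]; linarith
  have hed : e < d := by simp only [e]; linarith
  have hsub : Ioc a e ⊆ Ioo a b := fun x hx =>
    ⟨hx.1, hx.2.trans_lt (hed.trans_le (min_le_left _ _))⟩
  have hle : ∀ x ∈ Ioc a e, f x ≤ C * (x - a) := by
    intro x hx
    have hxd : x < a + ε := hx.2.trans_lt (hed.trans_le (min_le_right _ _))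
    have := hball (y := x) (by rw [Real.dist_eq, abs_of_pos (by linarith [hx.1])]; linarith)
    rw [abs_of_pos (by linarith [hx.1] : 0 < x - a)] at this
    exact (le_abs_self _).trans this
  have hd : ∀ x ∈ Ioc a e, HasDerivAt (fun x => s x - Real.log (x - a) / C)
      (1 / f x - 1 / (x - a) / C) x := by
    intro x hx
    have h1 := ((hasDerivAt_id x).sub_const a).log (by simp; linarith [hx.1])
    exact (hs x (hsub hx)).sub (h1.div_const C)
  have hmono : MonotoneOn (fun x => s x - Real.log (x - a) / C) (Ioc a e) := by
    refine monotoneOn_of_deriv_nonneg (convex_Ioc a e)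
      (fun x hx => (hd x hx).continuousAt.continuousWithinAt) ?_ ?_
    · intro x hx
      rw [interior_Ioc] at hx
      exact (hd x (Ioo_subset_Ioc_self hx)).differentiableAt.differentiableWithinAt
    · intro x hx
      rw [interior_Ioc] at hx
      have hx' := Ioo_subset_Ioc_self hx
      rw [(hd x hx').deriv, sub_nonneg, div_div, mul_comm]
      exact one_div_le_one_div_of_le (hpos x (hsub hx')) (hle x hx')
  have hlog : Tendsto (fun x => s e - Real.log (e - a) / C + Real.log (x - a) / C) (𝓝[>] a)
      atBot := by
    refine tendsto_atBot_add_const_left _ _ (Tendsto.atBot_div_const hC ?_)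
    refine Real.tendsto_log_nhdsGT_zero.comp ?_
    refine tendsto_nhdsWithin_iff.2 ⟨?_, ?_⟩
    · have : Tendsto (fun x => x - a) (𝓝 a) (𝓝 (a - a)) := by
        exact (continuous_id.sub continuous_const).tendsto a
      rw [sub_self] at this
      exact this.mono_left nhdsWithin_le_nhds
    · filter_upwards [self_mem_nhdsWithin] with x hx
      exact mem_Ioi.2 (sub_pos.2 (mem_Ioi.1 hx))
  refine tendsto_atBot_mono' _ ?_ hlog
  filter_upwards [Ioc_mem_nhdsGT hae] with x hx
  have := hmono hx ⟨hae, le_rfl⟩ hx.2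
  simp only at this
  linarith

lemma IsProfile.exists_isCoordinate {f : ℝ → ℝ} (hf : IsProfile f) :
    ∃ s, IsCoordinate f s := by
  have hcont : ContinuousOn (fun x => 1 / f x) (Ioo (-1) 1) :=
    continuousOn_const.div (hf.contOn.mono Ioo_subset_Icc_self) fun x hx => (hf.pos x hx).ne'
  let s₀ : ℝ → ℝ := fun x => ∫ y in (0 : ℝ)..x, 1 / f y
  have hd₀ : ∀ x ∈ Ioo (-1 : ℝ) 1, HasDerivAt s₀ (1 / f x) x := by
    intro x hx
    have hsub : uIcc 0 x ⊆ Ioo (-1 : ℝ) 1 := ordConnected_Ioo.uIcc_subset (by norm_num) hx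
    refine integral_hasDerivAt_right (hcont.mono hsub).intervalIntegrable ?_
      (hcont.continuousAt (isOpen_Ioo.mem_nhds hx))
    exact hcont.stronglyMeasurableAtFilter isOpen_Ioo x hx
  let s : ℝ → ℝ := (Ioo (-1 : ℝ) 1).indicator s₀
  have hd : ∀ x ∈ Ioo (-1 : ℝ) 1, HasDerivAt s (1 / f x) x := by
    intro x hx
    refine (hd₀ x hx).congr_of_eventuallyEq ?_
    filter_upwards [isOpen_Ioo.mem_nhds hx] with y hy
    exact indicator_of_mem hy _
  refine ⟨s, ?_, hd, ?_, ?_⟩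
  · have hc : ContinuousOn s₀ (Ioo (-1) 1) :=
      fun x hx => (hd₀ x hx).continuousAt.continuousWithinAt
    classical
    simp only [s, ← piecewise_eq_indicator]
    exact hc.measurable_piecewise continuousOn_const measurableSet_Ioo
  · exact tendsto_atBot_of_hasDerivAt (by norm_num) hf.pos hd hf.zero_neg_one hf.deriv_neg_one
  · have hneg : ∀ x ∈ Ioo (-1 : ℝ) 1, -x ∈ Ioo (-1 : ℝ) 1 := fun x hx =>
      ⟨by linarith [hx.2], by linarith [hx.1]⟩
    have hrefl : Tendsto (fun x => -s (-x)) (𝓝[>] (-1)) atBot := by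
      refine tendsto_atBot_of_hasDerivAt (f := fun x => f (-x)) (c := 2) (b := 1) (by norm_num)
        (fun x hx => hf.pos _ (hneg x hx)) (fun x hx => ?_) (by simp [hf.zero_one]) ?_
      · have h1 := (hd (-x) (hneg x hx)).comp x (hasDerivAt_neg x)
        exact (by simpa using h1.neg : HasDerivAt (-s ∘ Neg.neg) (1 / f (-x)) x)
      · have h1 : HasDerivAt f (-2) (-(-1 : ℝ)) := by simpa using hf.deriv_one
        exact (by simpa using h1.comp (-1 : ℝ) (hasDerivAt_neg (-1 : ℝ)) :
          HasDerivAt (f ∘ Neg.neg) 2 (-1))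
    have hmap : Tendsto (fun x : ℝ => -x) (𝓝[<] 1) (𝓝[>] (-1)) := tendsto_neg_nhdsLT
    simpa [Function.comp_def] using tendsto_neg_atBot_atTop.comp (hrefl.comp hmap)

end Coordinate
/-! ### Eigenfunctions of the Green operator -/

section Eigenfunctions

open Topology
open scoped InnerProductSpace

variable {f s : ℝ → ℝ} {k : ℝ}

lemma IsCoordinate.continuousOn (hs : IsCoordinate f s) : ContinuousOn s (Ioo (-1) 1) :=
  fun x hx => (hs.hasDerivAt x hx).continuousAt.continuousWithinAt

lemma IsCoordinate.strictMonoOn (hf : IsProfile f) (hs : IsCoordinate f s) :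
    StrictMonoOn s (Ioo (-1) 1) := by
  refine strictMonoOn_of_deriv_pos (convex_Ioo _ _) hs.continuousOn fun x hx => ?_
  rw [interior_Ioo] at hx
  rw [(hs.hasDerivAt x hx).deriv]
  exact one_div_pos.2 (hf.pos x hx)

lemma IsCoordinate.measure_level_eq_zero (hf : IsProfile f) (hs : IsCoordinate f s) (r : ℝ) :
    volume.restrict (Ioo (-1 : ℝ) 1) {x | s x = r} = 0 := by
  change volume.restrict _ (s ⁻¹' {r}) = 0
  rw [Measure.restrict_apply (hs.measurable (measurableSet_singleton r))]
  refine Set.Subsingleton.measure_zero (fun x hx y hy => ?_) volume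
  exact (hs.strictMonoOn hf).injOn hx.2 hy.2 (hx.1.trans hy.1.symm)

lemma IsCoordinate.contDiffOn (hf : IsProfile f) (hs : IsCoordinate f s) :
    ContDiffOn ℝ (⊤ : ℕ∞) s (Ioo (-1) 1) := by
  refine (contDiffOn_infty_iff_deriv_of_isOpen isOpen_Ioo).2
    ⟨fun x hx => (hs.hasDerivAt x hx).differentiableAt.differentiableWithinAt, ?_⟩
  refine ContDiffOn.congr (f₁ := deriv s) (f := fun x => 1 / f x) ?_
    fun x hx => (hs.hasDerivAt x hx).deriv
  exact contDiffOn_const.div hf.smoothOn fun x hx => (hf.pos x hx).ne'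

/-- The pair `(A, B)` solves the first order system equivalent to the eigenvalue equation for
`c * (exp (-k s) * A + exp (k s) * B)`. -/
structure IsSolution (k c : ℝ) (s A B : ℝ → ℝ) : Prop where
  left : ∀ x ∈ Ioo (-1 : ℝ) 1, HasDerivAt A (c * (A x + Real.exp (2 * k * s x) * B x)) x
  right : ∀ x ∈ Ioo (-1 : ℝ) 1, HasDerivAt B (-(c * (Real.exp (-(2 * k * s x)) * A x + B x))) x

/-- The function `c * (exp (-k s) * A + exp (k s) * B)`. -/
noncomputable def profileSum (k c : ℝ) (s A B : ℝ → ℝ) (x : ℝ) : ℝ :=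
  c * (Real.exp (-k * s x) * A x + Real.exp (k * s x) * B x)

lemma IsSolution.eq_zero {c : ℝ} {A B : ℝ → ℝ} (hs : ContinuousOn s (Ioo (-1) 1))
    (h : IsSolution k c s A B) (hA : A 0 = 0) (hB : B 0 = 0) :
    ∀ x ∈ Ioo (-1 : ℝ) 1, A x = 0 ∧ B x = 0 := by
  intro x hx
  obtain ⟨r, hxr, hr1⟩ := exists_between (abs_lt.2 ⟨by linarith [hx.1], hx.2⟩)
  have hr0 : 0 < r := (abs_nonneg x).trans_lt hxr
  have hsub : Icc (-r) r ⊆ Ioo (-1 : ℝ) 1 := fun t ht =>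
    ⟨by linarith [ht.1], by linarith [ht.2]⟩
  obtain ⟨M, hM⟩ := isCompact_Icc.exists_bound_of_continuousOn (hs.mono hsub)
  have hM0 : 0 ≤ M := (norm_nonneg _).trans (hM 0 ⟨by linarith, by linarith⟩)
  set N := Real.exp (2 * |k| * M)
  have hN : ∀ t ∈ Icc (-r) r, Real.exp (2 * k * s t) ≤ N ∧ Real.exp (-(2 * k * s t)) ≤ N := by
    intro t ht
    have h1 : |k * s t| ≤ |k| * M := by
      rw [abs_mul]; exact mul_le_mul_of_nonneg_left (hM t ht) (abs_nonneg _)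
    have h2 := abs_le.1 h1
    constructor <;> rw [Real.exp_le_exp] <;> nlinarith
  let v : ℝ → ℝ × ℝ → ℝ × ℝ := fun t p =>
    (c * (p.1 + Real.exp (2 * k * s t) * p.2), -(c * (Real.exp (-(2 * k * s t)) * p.1 + p.2)))
  have hlip : ∀ t ∈ Ioo (-r) r, LipschitzOnWith (Real.toNNReal (|c| * (1 + N))) (v t) univ := by
    intro t ht
    obtain ⟨h1, h2⟩ := hN t (Ioo_subset_Icc_self ht)
    refine LipschitzOnWith.of_dist_le_mul fun p _ q _ => ?_
    rw [Real.coe_toNNReal _ (by positivity)]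
    have hp1 : |p.1 - q.1| ≤ dist p q := by rw [Prod.dist_eq]; exact le_max_left _ _
    have hp2 : |p.2 - q.2| ≤ dist p q := by rw [Prod.dist_eq]; exact le_max_right _ _
    rw [Prod.dist_eq (x := v t p)]
    refine max_le ?_ ?_
    · rw [Real.dist_eq]
      have : (v t p).1 - (v t q).1 =
          c * ((p.1 - q.1) + Real.exp (2 * k * s t) * (p.2 - q.2)) := by simp only [v]; ring
      rw [this, abs_mul, mul_assoc |c|]
      refine mul_le_mul_of_nonneg_left ((abs_add_le _ _).trans ?_) (abs_nonneg c)
      rw [abs_mul, abs_of_pos (Real.exp_pos _), add_mul, one_mul]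
      gcongr
    · rw [Real.dist_eq]
      have : (v t p).2 - (v t q).2 =
          -(c * ((p.2 - q.2) + Real.exp (-(2 * k * s t)) * (p.1 - q.1))) := by
        simp only [v]; ring
      rw [this, abs_neg, abs_mul, mul_assoc |c|]
      refine mul_le_mul_of_nonneg_left ((abs_add_le _ _).trans ?_) (abs_nonneg c)
      rw [abs_mul, abs_of_pos (Real.exp_pos _), add_mul, one_mul]
      gcongr
  have hder : ∀ t ∈ Icc (-r) r, HasDerivAt (fun t => (A t, B t)) (v t (A t, B t)) t :=
    fun t ht => (h.left t (hsub ht)).prodMk (h.right t (hsub ht))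
  have heq := ODE_solution_unique_of_mem_Icc (v := v) (s := fun _ => univ) (t₀ := 0)
    (f := fun t => (A t, B t)) (g := fun _ => ((0 : ℝ), (0 : ℝ))) hlip ⟨by linarith, hr0⟩
    (fun t ht => (hder t ht).continuousAt.continuousWithinAt)
    (fun t ht => hder t (Ioo_subset_Icc_self ht)) (fun _ _ => mem_univ _) continuousOn_const
    (fun t _ => (hasDerivAt_const t ((0 : ℝ), (0 : ℝ))).congr_deriv (by simp [v]; rfl))
    (fun _ _ => mem_univ _) (by simp [hA, hB])
  have := heq (abs_le.1 hxr.le)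
  exact ⟨congrArg Prod.fst this, congrArg Prod.snd this⟩

lemma IsSolution.contDiffOn {c : ℝ} {A B : ℝ → ℝ} (hs : ContDiffOn ℝ (⊤ : ℕ∞) s (Ioo (-1) 1))
    (h : IsSolution k c s A B) :
    ContDiffOn ℝ (⊤ : ℕ∞) A (Ioo (-1) 1) ∧ ContDiffOn ℝ (⊤ : ℕ∞) B (Ioo (-1) 1) := by
  suffices H : ∀ n : ℕ, ContDiffOn ℝ n A (Ioo (-1) 1) ∧ ContDiffOn ℝ n B (Ioo (-1) 1) from
    ⟨contDiffOn_infty.2 fun n => (H n).1, contDiffOn_infty.2 fun n => (H n).2⟩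
  intro n
  induction n with
  | zero =>
    simp only [Nat.cast_zero, contDiffOn_zero]
    exact ⟨fun x hx => (h.left x hx).continuousAt.continuousWithinAt,
      fun x hx => (h.right x hx).continuousAt.continuousWithinAt⟩
  | succ n ih =>
    have hs' : ContDiffOn ℝ n s (Ioo (-1) 1) := contDiffOn_infty.1 hs n
    have he : ContDiffOn ℝ n (fun x => 2 * k * s x) (Ioo (-1) 1) := contDiffOn_const.mul hs'
    push_cast
    constructor
    · refine (contDiffOn_succ_iff_deriv_of_isOpen isOpen_Ioo).2
        ⟨fun x hx => (h.left x hx).differentiableAt.differentiableWithinAt, by simp, ?_⟩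
      refine ContDiffOn.congr ?_ fun x hx => (h.left x hx).deriv
      exact contDiffOn_const.mul (ih.1.add (he.exp.mul ih.2))
    · refine (contDiffOn_succ_iff_deriv_of_isOpen isOpen_Ioo).2
        ⟨fun x hx => (h.right x hx).differentiableAt.differentiableWithinAt, by simp, ?_⟩
      refine ContDiffOn.congr ?_ fun x hx => (h.right x hx).deriv
      exact (contDiffOn_const.mul ((he.neg.exp.mul ih.1).add ih.2)).neg

lemma exp_mul_mul_exp_two_mul (k t : ℝ) :
    Real.exp (-k * t) * Real.exp (2 * k * t) = Real.exp (k * t) := by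
  rw [← Real.exp_add]; ring_nf

lemma exp_mul_mul_exp_neg_two_mul (k t : ℝ) :
    Real.exp (k * t) * Real.exp (-(2 * k * t)) = Real.exp (-k * t) := by
  rw [← Real.exp_add]; ring_nf

lemma IsSolution.hasDerivAt_exp_mul_left {c : ℝ} {A B : ℝ → ℝ} (hs : IsCoordinate f s)
    (h : IsSolution k c s A B) {x : ℝ} (hx : x ∈ Ioo (-1 : ℝ) 1) :
    HasDerivAt (fun x => Real.exp (-k * s x) * A x)
      (-k / f x * (Real.exp (-k * s x) * A x) + profileSum k c s A B x) x := by
  have h1 := (((hs.hasDerivAt x hx).const_mul (-k)).exp).mul (h.left x hx)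
  refine h1.congr_deriv ?_
  rw [profileSum, ← exp_mul_mul_exp_two_mul k (s x)]
  ring

lemma IsSolution.hasDerivAt_exp_mul_right {c : ℝ} {A B : ℝ → ℝ} (hs : IsCoordinate f s)
    (h : IsSolution k c s A B) {x : ℝ} (hx : x ∈ Ioo (-1 : ℝ) 1) :
    HasDerivAt (fun x => Real.exp (k * s x) * B x)
      (k / f x * (Real.exp (k * s x) * B x) - profileSum k c s A B x) x := by
  have h1 := (((hs.hasDerivAt x hx).const_mul k).exp).mul (h.right x hx)
  refine h1.congr_deriv ?_
  rw [profileSum, ← exp_mul_mul_exp_neg_two_mul k (s x)]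
  ring

lemma IsSolution.inSpec {n : ℕ} {c : ℝ} {A B : ℝ → ℝ} (hf : IsProfile f) (hs : IsCoordinate f s)
    (h : IsSolution n c s A B)
    (hleft : Tendsto (profileSum n c s A B) (𝓝[>] (-1)) (𝓝 0))
    (hright : Tendsto (profileSum n c s A B) (𝓝[<] 1) (𝓝 0))
    (hne : ∃ x ∈ Ioo (-1 : ℝ) 1, profileSum n c s A B x ≠ 0) :
    InSpec f n (2 * n * c) := by
  set w := profileSum n c s A B
  have hw : ∀ x ∈ Ioo (-1 : ℝ) 1, (Ioo (-1 : ℝ) 1).indicator w =ᶠ[𝓝 x] w := fun x hx => by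
    filter_upwards [isOpen_Ioo.mem_nhds hx] with y hy
    exact indicator_of_mem hy _
  obtain ⟨hA, hB⟩ := h.contDiffOn (hs.contDiffOn hf)
  have hsm := hs.contDiffOn hf
  have hwsmooth : ContDiffOn ℝ (⊤ : ℕ∞) w (Ioo (-1) 1) :=
    contDiffOn_const.mul (((contDiffOn_const.mul hsm).exp.mul hA).add
      ((contDiffOn_const.mul hsm).exp.mul hB))
  refine ⟨(Ioo (-1 : ℝ) 1).indicator w, ?_, ?_, ?_, ?_, ?_⟩
  · have hz1 : (Ioo (-1 : ℝ) 1).indicator w (-1) = 0 := by simp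
    have hz2 : (Ioo (-1 : ℝ) 1).indicator w 1 = 0 := by simp
    intro x hx
    rcases hx.1.eq_or_lt with rfl | h1
    · refine ContinuousWithinAt.mono (t := Ici (-1)) ?_ fun y hy => hy.1
      rw [← continuousWithinAt_Ioi_iff_Ici, ContinuousWithinAt, hz1]
      refine hleft.congr' ?_
      filter_upwards [Ioo_mem_nhdsGT (by norm_num : (-1 : ℝ) < 1)] with y hy
      exact (indicator_of_mem hy _).symm
    rcases hx.2.eq_or_lt with rfl | h2
    · refine ContinuousWithinAt.mono (t := Iic 1) ?_ fun y hy => hy.2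
      rw [← continuousWithinAt_Iio_iff_Iic, ContinuousWithinAt, hz2]
      refine hright.congr' ?_
      filter_upwards [Ioo_mem_nhdsLT (by norm_num : (-1 : ℝ) < 1)] with y hy
      exact (indicator_of_mem hy _).symm
    · have h3 := hwsmooth.continuousOn.continuousAt (isOpen_Ioo.mem_nhds ⟨h1, h2⟩)
      exact (h3.congr (hw x ⟨h1, h2⟩).symm).continuousWithinAt
  · exact hwsmooth.congr fun x hx => indicator_of_mem hx _
  · obtain ⟨x, hx, hxw⟩ := hne
    exact ⟨x, hx, by rwa [indicator_of_mem hx]⟩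
  · intro _
    simp
  · intro x hx
    have hd : ∀ y ∈ Ioo (-1 : ℝ) 1, f y * deriv ((Ioo (-1 : ℝ) 1).indicator w) y =
        c * n * (Real.exp (n * s y) * B y - Real.exp (-n * s y) * A y) := by
      intro y hy
      have h1 := ((h.hasDerivAt_exp_mul_left hs hy).add
        (h.hasDerivAt_exp_mul_right hs hy)).const_mul c
      have h2 : HasDerivAt w _ y := h1
      rw [(hw y hy).deriv_eq, h2.deriv]
      have := (hf.pos y hy).ne'
      field_simp
      ring
    have hev : (fun y => f y * deriv ((Ioo (-1 : ℝ) 1).indicator w) y) =ᶠ[𝓝 x]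
        fun y => c * n * (Real.exp (n * s y) * B y - Real.exp (-n * s y) * A y) := by
      filter_upwards [isOpen_Ioo.mem_nhds hx] with y hy
      exact hd y hy
    have h2 := (((h.hasDerivAt_exp_mul_right hs hx).sub
      (h.hasDerivAt_exp_mul_left hs hx)).const_mul (c * n))
    have h3 : HasDerivAt (fun y => c * n * (Real.exp (n * s y) * B y -
      Real.exp (-n * s y) * A y)) _ x := h2
    rw [hev.deriv_eq, h3.deriv, indicator_of_mem hx]
    change _ + (n : ℝ) ^ 2 / f x * w x = 2 * n * c * w x
    have hwx : w x = c * (Real.exp (-n * s x) * A x + Real.exp (n * s x) * B x) := rfl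
    have := (hf.pos x hx).ne'
    change -(c * n * (n / f x * (Real.exp (n * s x) * B x) - w x -
      (-n / f x * (Real.exp (-n * s x) * A x) + w x))) + (n : ℝ) ^ 2 / f x * w x = 2 * n * c * w x
    generalize Real.exp (n * s x) * B x = b at *
    generalize Real.exp (-n * s x) * A x = a at *
    rw [hwx]
    field_simp
    ring

end Eigenfunctions

/-! ### Solutions attached to eigenvectors -/

section Eigenvectors

open Topology
open scoped InnerProductSpace

variable {f s : ℝ → ℝ} {k : ℝ}

/-- A solution both of whose components, suitably normalized, vanish at `±1`. -/
structure IsDecayingSolution (k c : ℝ) (s A B : ℝ → ℝ) : Prop extends IsSolution k c s A B where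
  decay_left : ∀ l : Filter ℝ, l = 𝓝[>] (-1) ∨ l = 𝓝[<] 1 →
    Tendsto (fun x => Real.exp (-k * s x) * A x) l (𝓝 0)
  decay_right : ∀ l : Filter ℝ, l = 𝓝[>] (-1) ∨ l = 𝓝[<] 1 →
    Tendsto (fun x => Real.exp (k * s x) * B x) l (𝓝 0)

lemma halfKernel_le_exp (x y : ℝ) :
    halfKernel k s (s y) x ≤ Real.exp (-k * |s x - s y|) := by
  unfold halfKernel
  split_ifs with h
  · rw [abs_of_pos (sub_pos.2 h)]
  · positivity

lemma halfKernel_add_halfKernel {x y : ℝ} (h : s y ≠ s x) :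
    greenKernel k s x y = (halfKernel k s (s y) x + halfKernel k s (s x) y) / (2 * k) := by
  unfold greenKernel halfKernel
  rcases lt_or_gt_of_ne h with h | h
  · rw [if_pos h, if_neg h.not_gt, abs_of_pos (sub_pos.2 h), add_zero]
  · rw [if_neg h.not_gt, if_pos h, abs_of_neg (sub_neg.2 h), zero_add, neg_sub]

lemma tendsto_integral_kernel_mul {m : Measure ℝ} {l : Filter ℝ} [l.IsCountablyGenerated]
    {K : ℝ → ℝ → ℝ} {v : ℝ → ℝ} (hk : 0 < k) (hK : ∀ x, Measurable (K x))
    (hb : ∀ x y, |K x y| ≤ Real.exp (-k * |s x - s y|)) (hv : Integrable v m)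
    (hl : Tendsto s l atBot ∨ Tendsto s l atTop) :
    Tendsto (fun x => ∫ y, K x y * v y ∂m) l (𝓝 0) := by
  have h0 : (0 : ℝ) = ∫ _ : ℝ, (0 : ℝ) ∂m := by simp
  rw [h0]
  refine tendsto_integral_filter_of_dominated_convergence (fun y => ‖v y‖)
    (.of_forall fun x => (hK x).aestronglyMeasurable.mul hv.aestronglyMeasurable)
    (.of_forall fun x => .of_forall fun y => ?_) hv.norm (.of_forall fun y => ?_)
  · rw [norm_mul]
    refine mul_le_of_le_one_left (norm_nonneg _) ((hb x y).trans ?_)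
    rw [Real.exp_le_one_iff]
    nlinarith [abs_nonneg (s x - s y)]
  · have h1 : Tendsto (fun x => |s x - s y|) l atTop := by
      rcases hl with h | h
      · exact tendsto_abs_atBot_atTop.comp (tendsto_atBot_add_const_right _ (-s y) h)
      · exact tendsto_abs_atTop_atTop.comp (tendsto_atTop_add_const_right _ (-s y) h)
    have h2 : Tendsto (fun x => Real.exp (-k * |s x - s y|)) l (𝓝 0) :=
      Real.tendsto_exp_atBot.comp (h1.const_mul_atTop_of_neg (neg_lt_zero.2 hk))
    have h3 : Tendsto (fun x => K x y) l (𝓝 0) :=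
      squeeze_zero_norm (fun x => hb x y) h2
    simpa using h3.mul_const (v y)

lemma intervalIntegrable_exp_mul_left (hf : IsProfile f) (hs : IsCoordinate f s) (hk : 0 < k)
    {v : ℝ → ℝ} (hv : IntegrableOn v (Ioo (-1) 1)) {x : ℝ} (hx : x ∈ Ioo (-1 : ℝ) 1) :
    IntervalIntegrable (fun y => Real.exp (k * s y) * v y) volume (-1) x := by
  rw [intervalIntegrable_iff_integrableOn_Ioo_of_le hx.1.le]
  refine Integrable.bdd_mul (c := Real.exp (k * s x))
    (hv.mono_set (Ioo_subset_Ioo_right hx.2.le)) ?_ ?_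
  · have := hs.measurable
    exact Measurable.aestronglyMeasurable (by fun_prop)
  · refine (ae_restrict_iff' measurableSet_Ioo).2 (.of_forall fun y hy => ?_)
    rw [Real.norm_of_nonneg (Real.exp_pos _).le, Real.exp_le_exp]
    have := hs.strictMonoOn hf ⟨hy.1, hy.2.trans hx.2⟩ hx hy.2
    nlinarith

lemma intervalIntegrable_exp_mul_right (hf : IsProfile f) (hs : IsCoordinate f s) (hk : 0 < k)
    {v : ℝ → ℝ} (hv : IntegrableOn v (Ioo (-1) 1)) {x : ℝ} (hx : x ∈ Ioo (-1 : ℝ) 1) :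
    IntervalIntegrable (fun y => Real.exp (-k * s y) * v y) volume x 1 := by
  rw [intervalIntegrable_iff_integrableOn_Ioo_of_le hx.2.le]
  refine Integrable.bdd_mul (c := Real.exp (-k * s x))
    (hv.mono_set (Ioo_subset_Ioo_left hx.1.le)) ?_ ?_
  · have := hs.measurable
    exact Measurable.aestronglyMeasurable (by fun_prop)
  · refine (ae_restrict_iff' measurableSet_Ioo).2 (.of_forall fun y hy => ?_)
    rw [Real.norm_of_nonneg (Real.exp_pos _).le, Real.exp_le_exp]
    have := hs.strictMonoOn hf hx ⟨hx.1.trans hy.1, hy.2⟩ hy.1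
    nlinarith

lemma exp_mul_integral_left (hf : IsProfile f) (hs : IsCoordinate f s) (v : ℝ → ℝ) {x : ℝ}
    (hx : x ∈ Ioo (-1 : ℝ) 1) :
    Real.exp (-k * s x) * ∫ y in (-1)..x, Real.exp (k * s y) * v y =
      ∫ y in Ioo (-1) 1, halfKernel k s (s y) x * v y := by
  rw [intervalIntegral.integral_of_le hx.1.le, integral_Ioc_eq_integral_Ioo,
    ← MeasureTheory.integral_const_mul,
    setIntegral_eq_of_subset_of_forall_sdiff_eq_zero measurableSet_Ioo
      (Ioo_subset_Ioo_right hx.2.le)]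
  · refine setIntegral_congr_fun measurableSet_Ioo fun y hy => ?_
    have := hs.strictMonoOn hf ⟨hy.1, hy.2.trans hx.2⟩ hx hy.2
    simp only [halfKernel, if_pos this]
    rw [← mul_assoc, ← Real.exp_add]
    ring_nf
  · intro y hy
    have hxy : x ≤ y := not_lt.1 fun h => hy.2 ⟨hy.1.1, h⟩
    have := (hs.strictMonoOn hf).monotoneOn hx hy.1 hxy
    simp [halfKernel, this.not_gt]

lemma exp_mul_integral_right (hf : IsProfile f) (hs : IsCoordinate f s) (v : ℝ → ℝ) {x : ℝ}
    (hx : x ∈ Ioo (-1 : ℝ) 1) :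
    Real.exp (k * s x) * ∫ y in x..1, Real.exp (-k * s y) * v y =
      ∫ y in Ioo (-1) 1, halfKernel k s (s x) y * v y := by
  rw [intervalIntegral.integral_of_le hx.2.le, integral_Ioc_eq_integral_Ioo,
    ← MeasureTheory.integral_const_mul,
    setIntegral_eq_of_subset_of_forall_sdiff_eq_zero measurableSet_Ioo
      (Ioo_subset_Ioo_left hx.1.le)]
  · refine setIntegral_congr_fun measurableSet_Ioo fun y hy => ?_
    have := hs.strictMonoOn hf hx ⟨hx.1.trans hy.1, hy.2⟩ hy.1
    simp only [halfKernel, if_pos this]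
    rw [← mul_assoc, ← Real.exp_add]
    ring_nf
  · intro y hy
    have hxy : y ≤ x := not_lt.1 fun h => hy.2 ⟨h, hy.1.2⟩
    have := (hs.strictMonoOn hf).monotoneOn hy.1 hx hxy
    simp [halfKernel, this.not_gt]

/-- Eigenvectors of the Green operator come from decaying solutions. -/
lemma exists_isDecayingSolution (hf : IsProfile f) (hs : IsCoordinate f s) (hk : 0 < k) {μ : ℝ}
    (hμ : μ ≠ 0) {v : Lp ℝ 2 (volume.restrict (Ioo (-1 : ℝ) 1))}
    (hv : greenOp _ hk hs.measurable v = μ • v) :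
    ∃ A B, IsDecayingSolution k (μ⁻¹ / (2 * k)) s A B ∧
      v =ᵐ[volume.restrict (Ioo (-1 : ℝ) 1)] profileSum k (μ⁻¹ / (2 * k)) s A B := by
  set c := μ⁻¹ / (2 * k) with hc
  have hatom := hs.measure_level_eq_zero hf
  have hvi : IntegrableOn v (Ioo (-1) 1) := integrable_coe_L2 v
  set A : ℝ → ℝ := fun x => ∫ y in (-1)..x, Real.exp (k * s y) * v y with hA
  set B : ℝ → ℝ := fun x => ∫ y in x..1, Real.exp (-k * s y) * v y with hB
  have hhm := measurable_halfKernel (k := k) hs.measurable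
  have hm1 : ∀ x, Measurable fun y => halfKernel k s (s y) x := fun x =>
    hhm.comp (hs.measurable.prodMk measurable_const)
  have hm2 : ∀ x, Measurable fun y => halfKernel k s (s x) y := fun x =>
    hhm.comp (measurable_const.prodMk measurable_id)
  have hi1 : ∀ x, IntegrableOn (fun y => halfKernel k s (s y) x * v y) (Ioo (-1) 1) := fun x =>
    Integrable.bdd_mul (c := 1) hvi (hm1 x).aestronglyMeasurable (.of_forall fun y => by
      rw [Real.norm_of_nonneg (halfKernel_nonneg _ _)]; exact halfKernel_le_one hk _ _)
  have hi2 : ∀ x, IntegrableOn (fun y => halfKernel k s (s x) y * v y) (Ioo (-1) 1) := fun x =>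
    Integrable.bdd_mul (c := 1) hvi (hm2 x).aestronglyMeasurable (.of_forall fun y => by
      rw [Real.norm_of_nonneg (halfKernel_nonneg _ _)]; exact halfKernel_le_one hk _ _)
  have hae : v =ᵐ[volume.restrict (Ioo (-1 : ℝ) 1)] profileSum k c s A B := by
    have h1 := greenOp_ae_eq hk hs.measurable hatom v
    rw [hv] at h1
    filter_upwards [h1, Lp.coeFn_smul μ v, ae_restrict_mem measurableSet_Ioo] with x hx hx' hxI
    rw [hx', Pi.smul_apply, smul_eq_mul] at hx
    rw [profileSum, exp_mul_integral_left hf hs v hxI, exp_mul_integral_right hf hs v hxI,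
      ← integral_add (hi1 x) (hi2 x)]
    have h2 : ∫ y in Ioo (-1) 1, greenKernel k s x y * v y =
        (∫ y in Ioo (-1) 1, (halfKernel k s (s y) x * v y + halfKernel k s (s x) y * v y)) /
          (2 * k) := by
      rw [← MeasureTheory.integral_div]
      refine integral_congr_ae ?_
      have : ∀ᵐ y ∂volume.restrict (Ioo (-1 : ℝ) 1), s y ≠ s x := by
        rw [ae_iff]; simpa using hatom (s x)
      filter_upwards [this] with y hy
      rw [halfKernel_add_halfKernel hy]
      ring
    rw [h2] at hx
    rw [hc]
    field_simp
    field_simp at hx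
    linarith
  have hAc : ContinuousOn A (Ioo (-1) 1) := by
    intro x hx
    have hb : (x + 1) / 2 ∈ Ioo (-1 : ℝ) 1 := ⟨by linarith [hx.1], by linarith [hx.2]⟩
    have h1 := continuousOn_primitive_interval'
      (intervalIntegrable_exp_mul_left hf hs hk hvi hb) left_mem_uIcc
    refine (h1.continuousAt ?_).continuousWithinAt
    rw [uIcc_of_le hb.1.le]
    exact Icc_mem_nhds hx.1 (by linarith [hx.2])
  have hBc : ContinuousOn B (Ioo (-1) 1) := by
    intro x hx
    have hb : (x - 1) / 2 ∈ Ioo (-1 : ℝ) 1 := ⟨by linarith [hx.1], by linarith [hx.2]⟩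
    have h1 := continuousOn_primitive_interval'
      (intervalIntegrable_exp_mul_right hf hs hk hvi hb) right_mem_uIcc
    have h2 : ContinuousAt (fun x => ∫ y in (1 : ℝ)..x, Real.exp (-k * s y) * v y) x := by
      refine h1.continuousAt ?_
      rw [uIcc_of_le hb.2.le]
      exact Icc_mem_nhds (by linarith [hx.1]) hx.2
    have h3 : B = fun x => -∫ y in (1 : ℝ)..x, Real.exp (-k * s y) * v y := by
      ext x
      exact intervalIntegral.integral_symm _ _
    rw [h3]
    exact h2.neg.continuousWithinAt
  set w := profileSum k c s A B
  have hsc := hs.continuousOn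
  have hwc : ContinuousOn w (Ioo (-1) 1) :=
    continuousOn_const.mul (((continuousOn_const.mul hsc).rexp.mul hAc).add
      ((continuousOn_const.mul hsc).rexp.mul hBc))
  have hwi : IntegrableOn w (Ioo (-1) 1) := hvi.congr hae
  have haeI : ∀ᵐ y, y ∈ Ioo (-1 : ℝ) 1 → v y = w y := (ae_restrict_iff' measurableSet_Ioo).1 hae
  have hAw : ∀ x ∈ Ioo (-1 : ℝ) 1, A x = ∫ y in (-1)..x, Real.exp (k * s y) * w y := by
    intro x hx
    refine intervalIntegral.integral_congr_ae ?_
    filter_upwards [haeI] with y hy hyx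
    rw [uIoc_of_le hx.1.le] at hyx
    rw [hy ⟨hyx.1, hyx.2.trans_lt hx.2⟩]
  have hBw : ∀ x ∈ Ioo (-1 : ℝ) 1, B x = ∫ y in x..1, Real.exp (-k * s y) * w y := by
    intro x hx
    refine intervalIntegral.integral_congr_ae ?_
    filter_upwards [haeI, volume.ae_ne (1 : ℝ)] with y hy hy1 hyx
    rw [uIoc_of_le hx.2.le] at hyx
    rw [hy ⟨hx.1.trans hyx.1, lt_of_le_of_ne hyx.2 hy1⟩]
  have hg1 : ContinuousOn (fun y => Real.exp (k * s y) * w y) (Ioo (-1) 1) :=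
    (continuousOn_const.mul hsc).rexp.mul hwc
  have hg2 : ContinuousOn (fun y => Real.exp (-k * s y) * w y) (Ioo (-1) 1) :=
    (continuousOn_const.mul hsc).rexp.mul hwc
  have hIcg : ∀ l : Filter ℝ, l = 𝓝[>] (-1) ∨ l = 𝓝[<] 1 → l.IsCountablyGenerated ∧
      (Tendsto s l atBot ∨ Tendsto s l atTop) ∧ Ioo (-1) 1 ∈ l := by
    rintro l (rfl | rfl)
    · exact ⟨inferInstance, .inl hs.tendsto_left, Ioo_mem_nhdsGT (by norm_num)⟩
    · exact ⟨inferInstance, .inr hs.tendsto_right, Ioo_mem_nhdsLT (by norm_num)⟩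
  refine ⟨A, B, ⟨⟨fun x hx => ?_, fun x hx => ?_⟩, fun l hl => ?_, fun l hl => ?_⟩, hae⟩
  · have h1 := intervalIntegral.integral_hasDerivAt_right
      (intervalIntegrable_exp_mul_left hf hs hk hwi hx)
      (hg1.stronglyMeasurableAtFilter isOpen_Ioo x hx) (hg1.continuousAt (isOpen_Ioo.mem_nhds hx))
    have h2 : A =ᶠ[𝓝 x] fun x => ∫ y in (-1)..x, Real.exp (k * s y) * w y := by
      filter_upwards [isOpen_Ioo.mem_nhds hx] with y hy using hAw y hy
    refine (h1.congr_of_eventuallyEq h2).congr_deriv ?_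
    simp only [w, profileSum]
    have e1 : Real.exp (k * s x) * Real.exp (-k * s x) = 1 := by
      rw [← Real.exp_add]; simp
    have e2 : Real.exp (2 * k * s x) = Real.exp (k * s x) * Real.exp (k * s x) := by
      rw [← Real.exp_add]; ring_nf
    rw [e2]
    linear_combination c * A x * e1
  · have h1 := intervalIntegral.integral_hasDerivAt_left
      (intervalIntegrable_exp_mul_right hf hs hk hwi hx)
      (hg2.stronglyMeasurableAtFilter isOpen_Ioo x hx) (hg2.continuousAt (isOpen_Ioo.mem_nhds hx))
    have h2 : B =ᶠ[𝓝 x] fun x => ∫ y in x..1, Real.exp (-k * s y) * w y := by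
      filter_upwards [isOpen_Ioo.mem_nhds hx] with y hy using hBw y hy
    refine (h1.congr_of_eventuallyEq h2).congr_deriv ?_
    simp only [w, profileSum]
    have e1 : Real.exp (k * s x) * Real.exp (-k * s x) = 1 := by
      rw [← Real.exp_add]; simp
    have e2 : Real.exp (-(2 * k * s x)) = Real.exp (-k * s x) * Real.exp (-k * s x) := by
      rw [← Real.exp_add]; ring_nf
    rw [e2]
    linear_combination -c * B x * e1
  · obtain ⟨_, h1, h2⟩ := hIcg l hl
    refine (tendsto_integral_kernel_mul (K := fun x y => halfKernel k s (s y) x) hk hm1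
      (fun x y => ?_) hvi h1).congr' ?_
    · rw [abs_of_nonneg (halfKernel_nonneg _ _)]
      exact halfKernel_le_exp x y
    · filter_upwards [h2] with x hx
      exact (exp_mul_integral_left hf hs v hx).symm
  · obtain ⟨_, h1, h2⟩ := hIcg l hl
    refine (tendsto_integral_kernel_mul (K := fun x y => halfKernel k s (s x) y) hk hm2
      (fun x y => ?_) hvi h1).congr' ?_
    · rw [abs_of_nonneg (halfKernel_nonneg _ _), abs_sub_comm]
      exact halfKernel_le_exp y x
    · filter_upwards [h2] with x hx
      exact (exp_mul_integral_right hf hs v hx).symm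

lemma IsDecayingSolution.tendsto_profileSum {c : ℝ} {A B : ℝ → ℝ}
    (h : IsDecayingSolution k c s A B) {l : Filter ℝ} (hl : l = 𝓝[>] (-1) ∨ l = 𝓝[<] 1) :
    Tendsto (profileSum k c s A B) l (𝓝 0) := by
  have := ((h.decay_left l hl).add (h.decay_right l hl)).const_mul c
  rwa [add_zero, mul_zero] at this

/-- The Wronskian of two decaying solutions vanishes. -/
lemma IsDecayingSolution.wronskian_eq_zero {c : ℝ} {A B A' B' : ℝ → ℝ}
    (h : IsDecayingSolution k c s A B) (h' : IsDecayingSolution k c s A' B') :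
    A 0 * B' 0 = A' 0 * B 0 := by
  set W : ℝ → ℝ := fun x => A x * B' x - A' x * B x
  have hd : ∀ x ∈ Ioo (-1 : ℝ) 1, HasDerivAt W 0 x := fun x hx => by
    refine (((h.left x hx).mul (h'.right x hx)).sub
      ((h'.left x hx).mul (h.right x hx))).congr_deriv ?_
    ring
  have hconst : ∀ x ∈ Ioo (-1 : ℝ) 1, W x = W 0 := fun x hx =>
    isOpen_Ioo.is_const_of_deriv_eq_zero isPreconnected_Ioo
      (fun y hy => (hd y hy).differentiableAt.differentiableWithinAt)
      (fun y hy => (hd y hy).deriv) hx ⟨by norm_num, by norm_num⟩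
  have hlim : Tendsto W (𝓝[>] (-1)) (𝓝 0) := by
    have h1 := ((h.decay_left _ (.inl rfl)).mul (h'.decay_right _ (.inl rfl))).sub
      ((h'.decay_left _ (.inl rfl)).mul (h.decay_right _ (.inl rfl)))
    simp only [mul_zero, sub_zero] at h1
    refine h1.congr fun x => ?_
    have e1 : Real.exp (k * s x) * Real.exp (-k * s x) = 1 := by
      rw [← Real.exp_add]; simp
    simp only [W]
    linear_combination (A x * B' x - A' x * B x) * e1
  have hlim' : Tendsto W (𝓝[>] (-1)) (𝓝 (W 0)) := by
    refine tendsto_const_nhds.congr' ?_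
    filter_upwards [Ioo_mem_nhdsGT (by norm_num : (-1 : ℝ) < 1)] with x hx
    exact (hconst x hx).symm
  exact sub_eq_zero.1 (tendsto_nhds_unique hlim' hlim)

lemma IsSolution.add_mul {c : ℝ} {A B A' B' : ℝ → ℝ} (h : IsSolution k c s A B)
    (h' : IsSolution k c s A' B') (a b : ℝ) :
    IsSolution k c s (fun x => a * A x + b * A' x) (fun x => a * B x + b * B' x) where
  left x hx := (((h.left x hx).const_mul a).add ((h'.left x hx).const_mul b)).congr_deriv (by ring)
  right x hx :=
    (((h.right x hx).const_mul a).add ((h'.right x hx).const_mul b)).congr_deriv (by ring)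

/-- The nonzero eigenvalues of the Green operator are simple. -/
lemma greenOp_simple (hf : IsProfile f) (hs : IsCoordinate f s) (hk : 0 < k) {μ : ℝ}
    (hμ : μ ≠ 0) {u v : Lp ℝ 2 (volume.restrict (Ioo (-1 : ℝ) 1))}
    (hu : greenOp _ hk hs.measurable u = μ • u) (hv : greenOp _ hk hs.measurable v = μ • v)
    (huv : ⟪u, v⟫_ℝ = 0) : u = 0 ∨ v = 0 := by
  obtain ⟨A, B, h, hue⟩ := exists_isDecayingSolution hf hs hk hμ hu
  obtain ⟨A', B', h', hve⟩ := exists_isDecayingSolution hf hs hk hμ hv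
  have key : ∀ a b : ℝ, a * A 0 + b * A' 0 = 0 → a * B 0 + b * B' 0 = 0 →
      a • u + b • v = 0 := by
    intro a b hA hB
    have hz := (h.toIsSolution.add_mul h'.toIsSolution a b).eq_zero hs.continuousOn hA hB
    refine (Lp.eq_zero_iff_ae_eq_zero).2 ?_
    filter_upwards [hue, hve, Lp.coeFn_add (a • u) (b • v), Lp.coeFn_smul a u, Lp.coeFn_smul b v,
      ae_restrict_mem measurableSet_Ioo] with x h1 h2 h3 h4 h5 hx
    obtain ⟨z1, z2⟩ := hz x hx
    rw [h3, Pi.add_apply, h4, h5, Pi.smul_apply, Pi.smul_apply, h1, h2, profileSum, profileSum]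
    simp only [smul_eq_mul, Pi.zero_apply]
    linear_combination μ⁻¹ / (2 * k) * (Real.exp (-k * s x) * z1 + Real.exp (k * s x) * z2)
  have horth : ∀ a b : ℝ, a • u + b • v = 0 → a * ‖u‖ ^ 2 = 0 ∧ b * ‖v‖ ^ 2 = 0 := by
    intro a b hab
    have h1 : ⟪u, a • u + b • v⟫_ℝ = 0 := by rw [hab, inner_zero_right]
    have h2 : ⟪v, a • u + b • v⟫_ℝ = 0 := by rw [hab, inner_zero_right]
    rw [inner_add_right, inner_smul_right, inner_smul_right, real_inner_self_eq_norm_sq] at h1 h2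
    rw [huv] at h1
    rw [real_inner_comm, huv] at h2
    simpa using And.intro h1 h2
  have hW := h.wronskian_eq_zero h'
  have fin : ∀ a b : ℝ, a • u + b • v = 0 → (a ≠ 0 ∨ b ≠ 0) → u = 0 ∨ v = 0 := by
    intro a b hab hne
    obtain ⟨h1, h2⟩ := horth a b hab
    rcases hne with ha | hb
    · exact .inl (by simpa [ha] using h1)
    · exact .inr (by simpa [hb] using h2)
  by_cases hA0 : A 0 = 0 ∧ A' 0 = 0
  · by_cases hB0 : B 0 = 0
    · exact fin 1 0 (key 1 0 (by simp [hA0]) (by simp [hB0])) (.inl one_ne_zero)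
    · exact fin (-B' 0) (B 0) (key _ _ (by simp [hA0]) (by ring)) (.inr hB0)
  · refine fin (A' 0) (-A 0) (key _ _ (by ring) (by linear_combination -hW)) ?_
    rw [neg_ne_zero]
    tauto

lemma greenOp_eigenvalue_pos (hf : IsProfile f) (hs : IsCoordinate f s) (hk : 0 < k) {μ : ℝ}
    (hμ : μ ≠ 0) {u : Lp ℝ 2 (volume.restrict (Ioo (-1 : ℝ) 1))} (hu0 : u ≠ 0)
    (hu : greenOp _ hk hs.measurable u = μ • u) : 0 < μ := by
  have h1 : 0 ≤ ⟪u, greenOp _ hk hs.measurable u⟫_ℝ := by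
    rw [greenOp, inner_covOp (memLp_halfVec hk hs.measurable (hs.measure_level_eq_zero hf))]
    exact integral_nonneg fun x => mul_self_nonneg _
  rw [hu, inner_smul_right, real_inner_self_eq_norm_sq] at h1
  have h2 : 0 < ‖u‖ ^ 2 := by positivity
  exact lt_of_le_of_ne (nonneg_of_mul_nonneg_left h1 h2) hμ.symm

/-- Inverses of nonzero eigenvalues of the Green operator are eigenvalues of `L_n`. -/
lemma inv_mem_Spec {n : ℕ} (hf : IsProfile f) (hs : IsCoordinate f s) (hn : 0 < (n : ℝ)) {μ : ℝ}
    (hμ : μ ≠ 0) {u : Lp ℝ 2 (volume.restrict (Ioo (-1 : ℝ) 1))} (hu0 : u ≠ 0)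
    (hu : greenOp _ hn hs.measurable u = μ • u) : μ⁻¹ ∈ Spec f n := by
  obtain ⟨A, B, h, hue⟩ := exists_isDecayingSolution hf hs hn hμ hu
  have h1 := h.toIsSolution.inSpec hf hs (h.tendsto_profileSum (.inl rfl))
    (h.tendsto_profileSum (.inr rfl)) (by
      by_contra! hz
      refine hu0 ((Lp.eq_zero_iff_ae_eq_zero).2 ?_)
      filter_upwards [hue, ae_restrict_mem measurableSet_Ioo] with x hx hxI
      rw [hx, hz x hxI, Pi.zero_apply])
  rwa [mul_div_cancel₀ _ (by positivity)] at h1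

end Eigenvectors

/-! ### Counting eigenvalues -/

section Counting

open Topology
open scoped InnerProductSpace

variable {f s : ℝ → ℝ}

lemma zero_mem_Eigs (f : ℝ → ℝ) : (0 : ℝ) ∈ Eigs f := by
  refine mem_iUnion.2 ⟨0, fun _ => 1, continuousOn_const, contDiffOn_const,
    ⟨0, ⟨by norm_num, by norm_num⟩, one_ne_zero⟩, by simp, fun x _ => ?_⟩
  simp

/-- Every nonzero eigenvalue of the Green operator is exceeded by one for any smaller `k`. -/
lemma exists_eigenvalue_gt {k k' : ℝ} (hf : IsProfile f) (hs : IsCoordinate f s) (hk : 0 < k)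
    (hk' : 0 < k') (hkk' : k < k') {μ : ℝ} (hμ : μ ≠ 0)
    {u : Lp ℝ 2 (volume.restrict (Ioo (-1 : ℝ) 1))} (hu0 : u ≠ 0)
    (hu : greenOp _ hk' hs.measurable u = μ • u) :
    ∃ μ', μ < μ' ∧ ∃ v : Lp ℝ 2 (volume.restrict (Ioo (-1 : ℝ) 1)), v ≠ 0 ∧
      greenOp _ hk hs.measurable v = μ' • v := by
  have hatom := hs.measure_level_eq_zero hf
  have hmem := memLp_halfVec hk hs.measurable hatom
  obtain ⟨w, hw, hlt⟩ := exists_inner_greenOp_lt hk hk' hkk' hs.measurable hatom hu0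
  by_contra! hcon
  have h1 := inner_le_of_forall_eigenvalue_le (T := greenOp _ hk hs.measurable)
    (isCompactOperator_covOp hmem) (isSymmetric_covOp hmem)
    (fun ν hν a b ha hb hab => greenOp_simple hf hs hk hν ha hb hab)
    (greenOp_eigenvalue_pos hf hs hk' hμ hu0 hu).le
    (fun ν _ v hv hv' => not_lt.1 fun h => hcon ν h v hv hv') w
  rw [hu, inner_smul_right, real_inner_self_eq_norm_sq, ← hw] at hlt
  exact hlt.not_ge h1

/-- Eigenvalues coming from `L_n` are preceded by at least `n` distinct eigenvalues. -/
lemma le_index (hf : IsProfile f) (hs : IsCoordinate f s) {Λ : ℕ → ℝ} (hΛmono : StrictMono Λ)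
    (hΛrange : Set.range Λ = Eigs f) {n : ℕ} (hn1 : 1 ≤ n) :
    ∀ (hn : 0 < (n : ℝ)) (μ : ℝ), μ ≠ 0 → ∀ u : Lp ℝ 2 (volume.restrict (Ioo (-1 : ℝ) 1)),
      u ≠ 0 → greenOp _ hn hs.measurable u = μ • u → ∀ j, Λ j = μ⁻¹ → n ≤ j := by
  induction n, hn1 using Nat.le_induction with
  | base =>
    intro hn μ hμ u hu0 hu j hj
    obtain ⟨i, hi⟩ : (0 : ℝ) ∈ Set.range Λ := hΛrange ▸ zero_mem_Eigs f
    have hpos := inv_pos.2 (greenOp_eigenvalue_pos hf hs hn hμ hu0 hu)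
    have : i < j := hΛmono.lt_iff_lt.1 (by rw [hi, hj]; exact hpos)
    omega
  | succ n hn1 ih =>
    intro hn μ hμ u hu0 hu j hj
    have hn' : 0 < (n : ℝ) := by exact_mod_cast hn1
    have hμpos := greenOp_eigenvalue_pos hf hs hn hμ hu0 hu
    obtain ⟨μ', hlt, v, hv0, hv⟩ :=
      exists_eigenvalue_gt hf hs hn' hn (by push_cast; linarith) hμ hu0 hu
    have hμ' : μ' ≠ 0 := (hμpos.trans hlt).ne'
    obtain ⟨i, hi⟩ : μ'⁻¹ ∈ Set.range Λ :=
      hΛrange ▸ mem_iUnion.2 ⟨n, inv_mem_Spec hf hs hn' hμ' hv0 hv⟩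
    have h1 := ih hn' μ' hμ' v hv0 hv i hi
    have : i < j := hΛmono.lt_iff_lt.1 (by rw [hi, hj]; exact inv_strictAnti₀ hμpos hlt)
    omega

lemma hasSum_inv_sq_add {k : ℕ} (hk : 1 ≤ k) :
    HasSum (fun j : ℕ => (((k + j : ℕ) : ℝ) ^ 2 + ((k + j : ℕ) : ℝ))⁻¹) (1 / (k : ℝ)) := by
  have hk0 : 0 < (k : ℝ) := by exact_mod_cast hk
  rw [hasSum_iff_tendsto_nat_of_nonneg fun j => by positivity]
  have h1 : ∀ N : ℕ, ∑ j ∈ Finset.range N, (((k + j : ℕ) : ℝ) ^ 2 + ((k + j : ℕ) : ℝ))⁻¹ =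
      1 / (k : ℝ) - 1 / ((k + N : ℕ) : ℝ) := by
    intro N
    have := Finset.sum_range_sub' (fun j : ℕ => 1 / ((k + j : ℕ) : ℝ)) N
    rw [add_zero] at this
    rw [← this]
    refine Finset.sum_congr rfl fun j _ => ?_
    push_cast
    have : (0 : ℝ) < k + j := by positivity
    field_simp
    ring
  simp only [h1]
  have h2 : Tendsto (fun N : ℕ => 1 / ((k + N : ℕ) : ℝ)) atTop (𝓝 0) :=
    tendsto_one_div_atTop_nhds_zero_nat.comp
      (tendsto_atTop_mono (fun N => Nat.le_add_left N k) tendsto_id)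
  simpa using h2.const_sub (1 / (k : ℝ))

/-- The trace of the Green operator of `L_k` bounds a tail of the inverse eigenvalues. -/
lemma ofReal_one_div_le_tsum (hf : IsProfile f) {Λ : ℕ → ℝ} (hΛmono : StrictMono Λ)
    (hΛrange : Set.range Λ = Eigs f) {k : ℕ} (hk : 1 ≤ k) :
    ENNReal.ofReal (1 / (k : ℝ)) ≤ ∑' j : ℕ, ENNReal.ofReal (Λ (k + j))⁻¹ := by
  obtain ⟨s, hs⟩ := hf.exists_isCoordinate
  have hk0 : 0 < (k : ℝ) := by exact_mod_cast hk
  have hatom := hs.measure_level_eq_zero hf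
  have : Fact ((2 : ENNReal) ≠ ⊤) := ⟨by simp⟩
  have htr := lintegral_enorm_sq_le_tsum_eigenvalues (memLp_halfVec hk0 hs.measurable hatom)
    (fun ν hν a b ha hb hab => greenOp_simple hf hs hk0 hν ha hb hab)
  rw [lintegral_norm_halfVec_sq] at htr
  have hleft : ENNReal.ofReal (1 / (2 * k : ℝ)) * volume.restrict (Ioo (-1 : ℝ) 1) univ =
      ENNReal.ofReal (1 / (k : ℝ)) := by
    rw [Measure.restrict_apply_univ, Real.volume_Ioo, ← ENNReal.ofReal_mul (by positivity)]
    congr 1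
    field_simp
    norm_num
  rw [hleft] at htr
  refine htr.trans ?_
  have hidx : ∀ μ : {μ : ℝ // μ ≠ 0 ∧ ∃ u : Lp ℝ 2 (volume.restrict (Ioo (-1 : ℝ) 1)),
      u ≠ 0 ∧ covOp volume (halfVec _ hk0 hs.measurable) u = μ • u},
      ∃ j : ℕ, Λ (k + j) = (μ : ℝ)⁻¹ := by
    rintro ⟨μ, hμ, u, hu0, hu⟩
    obtain ⟨i, hi⟩ : μ⁻¹ ∈ Set.range Λ :=
      hΛrange ▸ mem_iUnion.2 ⟨k, inv_mem_Spec hf hs hk0 hμ hu0 hu⟩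
    have := le_index hf hs hΛmono hΛrange hk hk0 μ hμ u hu0 hu i hi
    exact ⟨i - k, by rwa [Nat.add_sub_cancel' this]⟩
  choose ι hι using hidx
  have hinj : Function.Injective ι := fun a b hab => by
    have := hι a
    rw [hab, hι b] at this
    exact Subtype.ext (inv_injective this).symm
  calc _ = ∑' μ, ENNReal.ofReal (Λ (k + ι μ))⁻¹ := by simp only [hι, inv_inv]
    _ ≤ _ := ENNReal.tsum_comp_le_tsum_of_injective hinj
      fun j : ℕ => ENNReal.ofReal (Λ (k + j))⁻¹

end Counting

/-- Infinitely many distinct eigenvalues are bounded by those of the round sphere: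
for every `k ≥ 1` there is `m ≥ k` with `λ_m ≤ m² + m = λ_m(can)`. -/
theorem infinitely_many_below_round (f : ℝ → ℝ) (hf : IsProfile f)
    (Λ : ℕ → ℝ) (hΛmono : StrictMono Λ) (hΛrange : Set.range Λ = Eigs f) :
    ∀ k : ℕ, 1 ≤ k → ∃ m : ℕ, k ≤ m ∧ Λ m ≤ (m:ℝ)^2 + (m:ℝ) := by
  intro k hk
  by_contra! hcon
  have h1 := ofReal_one_div_le_tsum hf hΛmono hΛrange hk
  have hk0 : 0 < (k : ℝ) := by exact_mod_cast hk
  have hsum := hasSum_inv_sq_add hk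
  have hpos : ∀ j : ℕ, (0 : ℝ) < ((k + j : ℕ) : ℝ) ^ 2 + ((k + j : ℕ) : ℝ) := fun j => by
    push_cast
    positivity
  have hlt : ∀ j : ℕ, (Λ (k + j))⁻¹ < (((k + j : ℕ) : ℝ) ^ 2 + ((k + j : ℕ) : ℝ))⁻¹ :=
    fun j => inv_strictAnti₀ (hpos j) (hcon (k + j) (Nat.le_add_right k j))
  have hnn : ∀ j : ℕ, 0 ≤ (Λ (k + j))⁻¹ := fun j =>
    inv_nonneg.2 ((hpos j).trans (hcon (k + j) (Nat.le_add_right k j))).le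
  have hsumΛ : Summable fun j : ℕ => (Λ (k + j))⁻¹ :=
    Summable.of_nonneg_of_le hnn (fun j => (hlt j).le) hsum.summable
  rw [← ENNReal.ofReal_tsum_of_nonneg hnn hsumΛ,
    ENNReal.ofReal_le_ofReal_iff (tsum_nonneg hnn), ← hsum.tsum_eq] at h1
  exact h1.not_gt (hsumΛ.tsum_lt_tsum (fun j => (hlt j).le) (hlt 0) hsum.summable)
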